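/- arXiv:2505.15840 — 4 statements merged into one kernel-verified Lean document; each statement's English description precedes it below -/
import Mathlib

section
/- Let f ∈ [0,1] and let 0 ≤ b ≤ a be real numbers with a > 0. Let X and M be independent real random variables on a probability space, where X is Bernoulli with parameter f (P(X=1)=f, P(X=0)=1−f) and b ≤ M ≤ a almost surely. Set Y = X·M. Then the variance of Y satisfies: if 0 ≤ f ≤ (a+b)/(2a), then Var(Y) ≤ a²(f² − f + 1/2) + ab(1 − 2f) + b²/2; and if (a+b)/(2a) ≤ f ≤ 1, then Var(Y) ≤ (a² + 2ab + b² − 4fab)/4. -/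
open MeasureTheory ProbabilityTheory

/-- **Proposition 4.1.** Upper bound on the variance of `Y = X * M`, where `X` is a
Bernoulli spike with firing rate `f` and `M` is a clamped attention value in `[b, a]`. -/
theorem variance_mul_bernoulli_clamped_le
    {Ω : Type*} [MeasureSpace Ω] [IsProbabilityMeasure (ℙ : Measure Ω)]
    (f a b : ℝ) (hf0 : 0 ≤ f) (hf1 : f ≤ 1) (hb : 0 ≤ b) (hba : b ≤ a) (ha : 0 < a)
    (X M : Ω → ℝ) (hXmeas : Measurable X) (hMmeas : Measurable M)
    (hIndep : IndepFun X M ℙ)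
    (hX1 : ℙ (X ⁻¹' {1}) = ENNReal.ofReal f)
    (hX0 : ℙ (X ⁻¹' {0}) = ENNReal.ofReal (1 - f))
    (hM : ∀ᵐ ω ∂ℙ, M ω ∈ Set.Icc b a) :
    (f ≤ (a + b) / (2 * a) →
      Var[fun ω => X ω * M ω] ≤
        a ^ 2 * (f ^ 2 - f + 1 / 2) + a * b * (1 - 2 * f) + b ^ 2 / 2) ∧
    ((a + b) / (2 * a) ≤ f →
      Var[fun ω => X ω * M ω] ≤
        (a ^ 2 + 2 * a * b + b ^ 2 - 4 * f * a * b) / 4) := by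
  have hm1 : MeasurableSet (X ⁻¹' {1}) := hXmeas (measurableSet_singleton 1)
  have hm0 : MeasurableSet (X ⁻¹' {0}) := hXmeas (measurableSet_singleton 0)
  have hX01 : ∀ᵐ ω ∂(ℙ : Measure Ω), X ω = 1 ∨ X ω = 0 := by
    have hdis : Disjoint (X ⁻¹' {1}) (X ⁻¹' {0}) := by
      rw [Set.disjoint_left]
      intro ω h1 h0
      simp only [Set.mem_preimage, Set.mem_singleton_iff] at h1 h0
      linarith
    have hu : (ℙ : Measure Ω) (X ⁻¹' {1} ∪ X ⁻¹' {0}) = 1 := by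
      rw [measure_union hdis hm0, hX1, hX0, ← ENNReal.ofReal_add hf0 (by linarith)]
      simp
    exact (prob_compl_eq_zero_iff (hm1.union hm0)).2 hu
  have hXind : X =ᵐ[ℙ] (X ⁻¹' {1}).indicator (fun _ => (1 : ℝ)) := by
    filter_upwards [hX01] with ω h
    rcases h with h | h <;> simp [Set.indicator, h]
  have hXint : Integrable X ℙ :=
    ((integrable_const (1 : ℝ)).indicator hm1).congr hXind.symm
  have hEX : ∫ ω, X ω = f := by
    rw [integral_congr_ae hXind, integral_indicator hm1]
    simp [Measure.real, hX1, hf0]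
  have key : Var[fun ω => X ω * M ω] ≤ ((a + b) / 2) ^ 2 - f * (a * b) := by
    have hYm : AEStronglyMeasurable (fun ω => X ω * M ω) ℙ :=
      (hXmeas.mul hMmeas).aestronglyMeasurable
    have h1 := variance_sub_const hYm ((a + b) / 2)
    rw [← h1]
    refine (variance_le_expectation_sq (by fun_prop)).trans ?_
    have h2 : ∫ ω, (((a + b) / 2) ^ 2 - X ω * (a * b)) =
        ((a + b) / 2) ^ 2 - f * (a * b) := by
      rw [integral_sub (integrable_const _) (hXint.mul_const _), integral_mul_const, hEX]
      simp
    rw [← h2]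
    refine integral_mono_of_nonneg (Filter.Eventually.of_forall fun ω => sq_nonneg _)
      ((integrable_const _).sub (hXint.mul_const _)) ?_
    filter_upwards [hX01, hM] with ω h hMω
    obtain ⟨hl, hr⟩ := hMω
    simp only [Pi.pow_apply]
    rcases h with h | h
    · rw [h]; nlinarith [mul_nonneg (sub_nonneg.2 hl) (sub_nonneg.2 hr)]
    · rw [h]; nlinarith
  constructor
  · intro _
    nlinarith [sq_nonneg (a * (1 - 2 * f) + b)]
  · intro _
    nlinarith
end

section
/- Let f ∈ [0,1] and let 0 ≤ b ≤ a be real numbers. Let X and M be independent real random variables, where X is Bernoulli with parameter f and b ≤ M ≤ a almost surely. Then Var(X·M) ≤ (a² + 2ab + b² − 4fab)/4. -/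
open MeasureTheory ProbabilityTheory

/-- Unconditional upper bound on the variance of the processing-module output:
if `X` is Bernoulli with parameter `f ∈ [0,1]`, `M` takes values in `[b,a]` a.s. with
`0 ≤ b ≤ a`, and `X, M` are independent, then
`Var(X·M) ≤ (a² + 2ab + b² − 4fab)/4`. -/
theorem variance_mul_bernoulli_clamped_le_quarter
    {Ω : Type*} [MeasureSpace Ω] [IsProbabilityMeasure (ℙ : Measure Ω)]
    (f a b : ℝ) (hf0 : 0 ≤ f) (hf1 : f ≤ 1) (hb : 0 ≤ b) (hba : b ≤ a)
    (X M : Ω → ℝ) (hXmeas : Measurable X) (hMmeas : Measurable M)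
    (hIndep : IndepFun X M ℙ)
    (hX1 : ℙ (X ⁻¹' {1}) = ENNReal.ofReal f)
    (hX0 : ℙ (X ⁻¹' {0}) = ENNReal.ofReal (1 - f))
    (hM : ∀ᵐ ω ∂ℙ, M ω ∈ Set.Icc b a) :
    Var[fun ω => X ω * M ω] ≤ (a ^ 2 + 2 * a * b + b ^ 2 - 4 * f * a * b) / 4 := by
  have hm1 : MeasurableSet (X ⁻¹' {1}) := hXmeas (measurableSet_singleton 1)
  have hm0 : MeasurableSet (X ⁻¹' {0}) := hXmeas (measurableSet_singleton 0)
  have hX01 : ∀ᵐ ω ∂(ℙ : Measure Ω), X ω = 1 ∨ X ω = 0 := by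
    have hdisj : Disjoint (X ⁻¹' {1}) (X ⁻¹' {0}) := by
      rw [Set.disjoint_left]
      intro ω h1 h0
      simp only [Set.mem_preimage, Set.mem_singleton_iff] at h1 h0
      rw [h1] at h0
      exact one_ne_zero h0
    have hU : (ℙ : Measure Ω) (X ⁻¹' {1} ∪ X ⁻¹' {0}) = 1 := by
      rw [measure_union hdisj hm0, hX1, hX0, ← ENNReal.ofReal_add hf0 (by linarith)]
      simp
    have h := (mem_ae_iff_prob_eq_one (hm1.union hm0)).2 hU
    filter_upwards [h] with ω hω
    simpa using hω
  have hEX : ∫ ω, X ω = f := by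
    have h : X =ᵐ[ℙ] (X ⁻¹' {1}).indicator (fun _ => (1 : ℝ)) := by
      filter_upwards [hX01] with ω hω
      rcases hω with h | h <;> simp [Set.indicator, h]
    rw [integral_congr_ae h, integral_indicator_const _ hm1, Measure.real, hX1,
      ENNReal.toReal_ofReal hf0]
    simp
  have hXint : Integrable X ℙ := by
    refine Integrable.of_bound hXmeas.aestronglyMeasurable 1 ?_
    filter_upwards [hX01] with ω hω
    rcases hω with h | h <;> simp [h]
  have hYL : MemLp (fun ω => X ω * M ω) 2 ℙ := by
    refine MemLp.of_bound (hXmeas.mul hMmeas).aestronglyMeasurable a ?_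
    filter_upwards [hX01, hM] with ω hω hMω
    obtain ⟨h1, h2⟩ := hMω
    rcases hω with h | h
    · rw [h, one_mul, Real.norm_eq_abs, abs_of_nonneg (hb.trans h1)]
      exact h2
    · rw [h, zero_mul, norm_zero]
      exact hb.trans hba
  have hYint : Integrable (fun ω => X ω * M ω) ℙ := hYL.integrable (by norm_num)
  rw [variance_eq_sub hYL]
  have hsq : ∫ ω, ((fun ω => X ω * M ω) ^ 2) ω ≤
      (a + b) * (∫ ω, X ω * M ω) - a * b * f := by
    rw [← hEX, ← integral_const_mul, ← integral_const_mul,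
      ← integral_sub (hYint.const_mul _) (hXint.const_mul _)]
    refine integral_mono_ae hYL.integrable_sq
      ((hYint.const_mul _).sub (hXint.const_mul _)) ?_
    filter_upwards [hX01, hM] with ω hω hMω
    obtain ⟨h1, h2⟩ := hMω
    rcases hω with h | h
    · simp only [Pi.pow_apply, h]
      nlinarith [mul_nonneg (sub_nonneg.2 h1) (sub_nonneg.2 h2)]
    · simp [h]
  nlinarith [sq_nonneg ((∫ ω, X ω * M ω) - (a + b) / 2)]
end

section
/- Let 0 ≤ b < a be real numbers and let f satisfy (a+b)/(2a) ≤ f ≤ 1. Set p = (a + b − 2bf)/(2f(a − b)). Then 0 ≤ p ≤ 1, and if X and M are independent real random variables with X Bernoulli with parameter f and M taking the value a with probability p and the value b with probability 1 − p, then Var(X·M) = (a² + 2ab + b² − 4fab)/4. -/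
open MeasureTheory ProbabilityTheory

lemma two_point_ae {Ω : Type} [MeasurableSpace Ω] (μ : Measure Ω) [IsProbabilityMeasure μ]
    (Y : Ω → ℝ) (hY : Measurable Y) (u v q : ℝ) (huv : u ≠ v) (h0 : 0 ≤ q) (h1 : q ≤ 1)
    (hu : μ (Y ⁻¹' {u}) = ENNReal.ofReal q) (hv : μ (Y ⁻¹' {v}) = ENNReal.ofReal (1 - q)) :
    ∀ᵐ ω ∂μ, Y ω = u ∨ Y ω = v := by
  have hd : Disjoint (Y ⁻¹' {u}) (Y ⁻¹' {v}) :=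
    Disjoint.preimage _ (by simpa using huv)
  have hm : μ (Y ⁻¹' {u} ∪ Y ⁻¹' {v}) = 1 := by
    rw [measure_union hd (hY (measurableSet_singleton v)), hu, hv,
      ← ENNReal.ofReal_add h0 (by linarith)]
    simp
  have hms : MeasurableSet (Y ⁻¹' {u} ∪ Y ⁻¹' {v}) :=
    (hY (measurableSet_singleton u)).union (hY (measurableSet_singleton v))
  exact (mem_ae_iff_prob_eq_one hms).2 hm

lemma two_point_integral {Ω : Type} [MeasurableSpace Ω] (μ : Measure Ω) [IsProbabilityMeasure μ]
    (Y : Ω → ℝ) (hY : Measurable Y) (u v q : ℝ) (huv : u ≠ v) (h0 : 0 ≤ q) (h1 : q ≤ 1)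
    (hu : μ (Y ⁻¹' {u}) = ENNReal.ofReal q) (hv : μ (Y ⁻¹' {v}) = ENNReal.ofReal (1 - q))
    (g : ℝ → ℝ) : ∫ ω, g (Y ω) ∂μ = q * g u + (1 - q) * g v := by
  have hae := two_point_ae μ Y hY u v q huv h0 h1 hu hv
  have hms : MeasurableSet (Y ⁻¹' {u}) := hY (measurableSet_singleton u)
  have he : (fun ω => g (Y ω)) =ᵐ[μ]
      fun ω => g v + (Y ⁻¹' {u}).indicator (fun _ => g u - g v) ω := by
    filter_upwards [hae] with ω hω
    rcases hω with h | h
    · simp [Set.indicator, h]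
    · simp [Set.indicator, h, huv.symm]
  rw [integral_congr_ae he, integral_add (integrable_const _)
    ((integrable_const _).indicator hms), integral_indicator_const _ hms]
  simp [Measure.real, hu, ENNReal.toReal_ofReal h0]
  ring

/-- Attainability (Case 1) of the variance bound in Proposition 4.1: for
`(a+b)/(2a) ≤ f ≤ 1` and `p = (a + b − 2bf)/(2f(a − b))`, we have `0 ≤ p ≤ 1`, and the
two-point distribution `P(M = a) = p`, `P(M = b) = 1 − p` achieves
`Var(X·M) = (a² + 2ab + b² − 4fab)/4` for `X` Bernoulli with parameter `f`
independent of `M`. -/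
theorem variance_mul_bernoulli_two_point_eq
    (a b f : ℝ) (hb : 0 ≤ b) (hba : b < a) (hf1 : (a + b) / (2 * a) ≤ f) (hf2 : f ≤ 1) :
    0 ≤ (a + b - 2 * b * f) / (2 * f * (a - b)) ∧
    (a + b - 2 * b * f) / (2 * f * (a - b)) ≤ 1 ∧
    ∀ (Ω : Type) (_ : MeasureSpace Ω) (_ : IsProbabilityMeasure (ℙ : Measure Ω))
      (X M : Ω → ℝ), Measurable X → Measurable M → IndepFun X M ℙ →
      ℙ (X ⁻¹' {1}) = ENNReal.ofReal f →
      ℙ (X ⁻¹' {0}) = ENNReal.ofReal (1 - f) →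
      ℙ (M ⁻¹' {a}) = ENNReal.ofReal ((a + b - 2 * b * f) / (2 * f * (a - b))) →
      ℙ (M ⁻¹' {b}) = ENNReal.ofReal (1 - (a + b - 2 * b * f) / (2 * f * (a - b))) →
      Var[fun ω => X ω * M ω] = (a ^ 2 + 2 * a * b + b ^ 2 - 4 * f * a * b) / 4 := by
  have ha : 0 < a := by linarith
  have hab : 0 < a - b := by linarith
  have hf : 0 < f := lt_of_lt_of_le (by positivity) hf1
  have hf3 : a + b ≤ f * (2 * a) := (div_le_iff₀ (by positivity)).1 hf1
  have hp0 : 0 ≤ (a + b - 2 * b * f) / (2 * f * (a - b)) := by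
    apply div_nonneg
    · nlinarith
    · positivity
  have hp1 : (a + b - 2 * b * f) / (2 * f * (a - b)) ≤ 1 := by
    rw [div_le_one (by positivity)]
    nlinarith
  refine ⟨hp0, hp1, ?_⟩
  intro Ω _ _ X M hX hM hXM hX1 hX0 hMa hMb
  have hpeq : (a + b - 2 * b * f) / (2 * f * (a - b)) * (2 * f * (a - b)) = a + b - 2 * b * f :=
    div_mul_cancel₀ _ (by positivity)
  generalize (a + b - 2 * b * f) / (2 * f * (a - b)) = p at *
  have iX := two_point_integral ℙ X hX 1 0 f one_ne_zero hf.le hf2 hX1 hX0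
  have iM := two_point_integral ℙ M hM a b p hba.ne' hp0 hp1 hMa hMb
  have aX := two_point_ae ℙ X hX 1 0 f one_ne_zero hf.le hf2 hX1 hX0
  have aM := two_point_ae ℙ M hM a b p hba.ne' hp0 hp1 hMa hMb
  have hL : MemLp (fun ω => X ω * M ω) 2 (ℙ : Measure Ω) := by
    refine MemLp.of_bound (hX.mul hM).aestronglyMeasurable a ?_
    filter_upwards [aX, aM] with ω h1 h2
    rw [Real.norm_eq_abs, abs_le]
    rcases h1 with h1 | h1 <;> rcases h2 with h2 | h2 <;> rw [h1, h2] <;>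
      constructor <;> linarith
  have e1 : ∫ ω, X ω * M ω = (∫ ω, X ω) * ∫ ω, M ω :=
    hXM.integral_fun_mul_eq_mul_integral hX.aestronglyMeasurable hM.aestronglyMeasurable
  have hsq : Measurable (fun x : ℝ => x ^ 2) := by fun_prop
  have e2 : ∫ ω, X ω ^ 2 * M ω ^ 2 = (∫ ω, X ω ^ 2) * ∫ ω, M ω ^ 2 :=
    (hXM.comp hsq hsq).integral_fun_mul_eq_mul_integral
      (hsq.comp hX).aestronglyMeasurable (hsq.comp hM).aestronglyMeasurable
  have e3 : ∫ ω, ((fun ω => X ω * M ω) ^ 2) ω = ∫ ω, X ω ^ 2 * M ω ^ 2 := by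
    simp only [Pi.pow_apply, mul_pow]
  rw [variance_eq_sub hL, e3, e1, e2, iX (fun x => x ^ 2), iM (fun x => x ^ 2),
    iX (fun x => x), iM (fun x => x)]
  have k1 : (f * 1 + (1 - f) * 0) * (p * a + (1 - p) * b) = (a + b) / 2 := by
    linear_combination hpeq / 2
  rw [k1]
  linear_combination (a + b) / 2 * hpeq
end

section
/- Let 0 ≤ b ≤ a with a > 0, and let f satisfy 0 ≤ f ≤ (a+b)/(2a). Let X and M be independent real random variables, where X is Bernoulli with parameter f and b ≤ M ≤ a almost surely. Then Var(X·M) ≤ a²·f·(1−f), with equality when M = a almost surely. -/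
open MeasureTheory ProbabilityTheory

/-- Sharp low-firing-rate case (Case 2) of Proposition 4.1: for
`0 ≤ b ≤ a`, `a > 0` and `0 ≤ f ≤ (a+b)/(2a)`, if `X` is Bernoulli with parameter `f`,
`M ∈ [b,a]` a.s., and `X, M` are independent, then `Var(X·M) ≤ a²·f·(1−f)`, with
equality when `M = a` almost surely. -/
theorem variance_mul_bernoulli_clamped_le_of_small_f
    {Ω : Type*} [MeasureSpace Ω] [IsProbabilityMeasure (ℙ : Measure Ω)]
    (f a b : ℝ) (hf0 : 0 ≤ f) (hf1 : f ≤ (a + b) / (2 * a))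
    (hb : 0 ≤ b) (hba : b ≤ a) (ha : 0 < a)
    (X M : Ω → ℝ) (hXmeas : Measurable X) (hMmeas : Measurable M)
    (hIndep : IndepFun X M ℙ)
    (hX1 : ℙ (X ⁻¹' {1}) = ENNReal.ofReal f)
    (hX0 : ℙ (X ⁻¹' {0}) = ENNReal.ofReal (1 - f))
    (hM : ∀ᵐ ω ∂ℙ, M ω ∈ Set.Icc b a) :
    Var[fun ω => X ω * M ω] ≤ a ^ 2 * f * (1 - f) ∧
    ((∀ᵐ ω ∂ℙ, M ω = a) → Var[fun ω => X ω * M ω] = a ^ 2 * f * (1 - f)) := by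
  have hf1' : f ≤ 1 := hf1.trans (by rw [div_le_one (by positivity)]; linarith)
  have h2a : f * (2 * a) ≤ a + b := (le_div_iff₀ (by positivity)).1 hf1
  have hms1 : MeasurableSet (X ⁻¹' {1}) := hXmeas (measurableSet_singleton 1)
  have hms0 : MeasurableSet (X ⁻¹' {0}) := hXmeas (measurableSet_singleton 0)
  have hdisj : Disjoint (X ⁻¹' {1}) (X ⁻¹' {0}) := by
    apply Disjoint.preimage
    simp
  have hunion : ℙ (X ⁻¹' {1} ∪ X ⁻¹' {0}) = 1 := by
    rw [measure_union hdisj hms0, hX1, hX0, ← ENNReal.ofReal_add hf0 (by linarith)]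
    simp
  have hX : ∀ᵐ ω ∂ℙ, X ω = 1 ∨ X ω = 0 := by
    have h := (prob_compl_eq_zero_iff (hms1.union hms0)).2 hunion
    rw [ae_iff]
    exact h
  have hXind : X =ᵐ[ℙ] (X ⁻¹' {1}).indicator (fun _ => (1 : ℝ)) := by
    filter_upwards [hX] with ω hω
    rcases hω with h | h <;> simp [Set.indicator, h]
  have hEX : ∫ ω, X ω ∂ℙ = f := by
    rw [integral_congr_ae hXind, integral_indicator hms1]
    simp [Measure.real, hX1, hf0]
  have hM2L : MemLp M 2 ℙ := by
    refine MemLp.of_bound hMmeas.aestronglyMeasurable a ?_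
    filter_upwards [hM] with ω hω
    rw [Real.norm_eq_abs, abs_of_nonneg (hb.trans hω.1)]
    exact hω.2
  have hMint : Integrable M ℙ := hM2L.integrable (by norm_num)
  have hM2int : Integrable (fun ω => M ω ^ 2) ℙ := hM2L.integrable_sq
  have hEXM : ∫ ω, X ω * M ω ∂ℙ = f * ∫ ω, M ω ∂ℙ := by
    rw [hIndep.integral_fun_mul_eq_mul_integral hXmeas.aestronglyMeasurable
      hMmeas.aestronglyMeasurable, hEX]
  have hEXM2 : ∫ ω, (X ω * M ω) ^ 2 ∂ℙ = f * ∫ ω, M ω ^ 2 ∂ℙ := by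
    have hI : IndepFun X (fun ω => M ω ^ 2) ℙ :=
      hIndep.comp (φ := id) (ψ := fun x : ℝ => x ^ 2) measurable_id (by fun_prop)
    rw [← hEX, ← hI.integral_fun_mul_eq_mul_integral hXmeas.aestronglyMeasurable
      (hMmeas.pow_const 2).aestronglyMeasurable]
    apply integral_congr_ae
    filter_upwards [hX] with ω hω
    rcases hω with h | h <;> simp [h]
  have hXM : MemLp (fun ω => X ω * M ω) 2 ℙ := by
    refine MemLp.of_bound (hXmeas.mul hMmeas).aestronglyMeasurable a ?_
    filter_upwards [hM, hX] with ω hω hx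
    rw [Real.norm_eq_abs]
    rcases hx with h | h
    · rw [h, one_mul, abs_of_nonneg (hb.trans hω.1)]
      exact hω.2
    · simp [h, ha.le]
  have hVar : Var[fun ω => X ω * M ω] =
      f * (∫ ω, M ω ^ 2 ∂ℙ) - (f * ∫ ω, M ω ∂ℙ) ^ 2 := by
    rw [variance_eq_sub hXM, ← hEXM, ← hEXM2]
    rfl
  rw [hVar]
  constructor
  · have hma : ∫ ω, M ω ∂ℙ ≤ a := by
      have := integral_mono_ae hMint (integrable_const a)
        (by filter_upwards [hM] with ω hω using hω.2)
      simpa using this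
    have hs : ∫ ω, M ω ^ 2 ∂ℙ ≤ (a + b) * (∫ ω, M ω ∂ℙ) - a * b := by
      have := integral_mono_ae hM2int
        ((hMint.const_mul (a + b)).sub (integrable_const (a * b)))
        (by
          filter_upwards [hM] with ω hω
          simp only [Pi.sub_apply]
          nlinarith [mul_nonneg (sub_nonneg.2 hω.1) (sub_nonneg.2 hω.2)])
      have h2 : ∫ ω, ((a + b) * M ω - a * b) ∂ℙ
          = (a + b) * (∫ ω, M ω ∂ℙ) - a * b := by
        rw [integral_sub (hMint.const_mul (a + b)) (integrable_const (a * b)),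
          integral_const_mul]
        simp
      exact this.trans h2.le
    generalize (∫ ω, M ω ∂ℙ) = m at *
    generalize (∫ ω, M ω ^ 2 ∂ℙ) = s at *
    have h1 : f * (a + m) ≤ a + b := by nlinarith
    have h3 : f * (a + m) * (a - m) ≤ (a + b) * (a - m) :=
      mul_le_mul_of_nonneg_right h1 (by linarith)
    have h4 : s - f * m ^ 2 ≤ a ^ 2 * (1 - f) := by nlinarith
    have := mul_le_mul_of_nonneg_left h4 hf0
    nlinarith
  · intro hMa
    have e1 : ∫ ω, M ω ∂ℙ = a := by
      rw [integral_congr_ae (g := fun _ => a) hMa]; simp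
    have e2 : ∫ ω, M ω ^ 2 ∂ℙ = a ^ 2 := by
      rw [integral_congr_ae (g := fun _ => a ^ 2)
        (by filter_upwards [hMa] with ω h; rw [h])]
      simp
    rw [e1, e2]
    ring
end
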